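/- Randomized Kaczmarz on inconsistent systems converges to a horizon: Let A ∈ ℝ^{m×n} have every row nonzero, b ∈ ℝ^m, and let x* satisfy the normal equations Aᵀ(A x* − b) = 0 with x* in the row space of A. Let σ > 0 satisfy ‖A v‖² ≥ σ² ‖v‖² for every v in the row space of A, and set ρ = 1 − σ²/‖A‖_F². Fix x^0 in the row space of A and for each index sequence ω = (i_1,…,i_k) ∈ {1,…,m}^k define RK iterates x^t(ω) = x^{t−1}(ω) − ((A_{i_t:} x^{t−1}(ω) − b_{i_t})/‖A_{i_t:}‖²) A_{i_t:}ᵀ. Then ∑_{ω ∈ {1,…,m}^k} (∏_{t=1}^k ‖A_{i_t:}‖²/‖A‖_F²) · ‖x^k(ω) − x*‖² ≤ ρ^k ‖x^0 − x*‖² + ((1 − ρ^k)/σ²) ‖A x* − b‖². -/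

import Mathlib

open Matrix BigOperators

/-- The randomized Kaczmarz update of `x` with row index `i`. -/
noncomputable def rkStep {m n : ℕ} (A : Matrix (Fin m) (Fin n) ℝ) (b : Fin m → ℝ)
    (x : Fin n → ℝ) (i : Fin m) : Fin n → ℝ :=
  x - ((A.mulVec x i - b i) / (∑ l, A i l ^ 2)) • A i

lemma row_sq_sum_pos {m n : ℕ} {A : Matrix (Fin m) (Fin n) ℝ} {i : Fin m} (h : A i ≠ 0) :
    0 < ∑ l, A i l ^ 2 := by
  obtain ⟨l, hl⟩ := Function.ne_iff.1 h
  exact Finset.sum_pos' (fun _ _ => sq_nonneg _) ⟨l, Finset.mem_univ l, sq_pos_of_ne_zero hl⟩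

lemma sum_mulVec_sq_le {m n : ℕ} (A : Matrix (Fin m) (Fin n) ℝ) (v : Fin n → ℝ) :
    ∑ i, A.mulVec v i ^ 2 ≤ (∑ i, ∑ l, A i l ^ 2) * ∑ l, v l ^ 2 := by
  rw [Finset.sum_mul]
  exact Finset.sum_le_sum fun i _ => Finset.sum_mul_sq_le_sq_mul_sq Finset.univ (A i) v

lemma rkStep_mem_span {m n : ℕ} (A : Matrix (Fin m) (Fin n) ℝ) (b : Fin m → ℝ)
    {x : Fin n → ℝ} (hx : x ∈ Submodule.span ℝ (Set.range fun i : Fin m => A i)) (i : Fin m) :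
    rkStep A b x i ∈ Submodule.span ℝ (Set.range fun i : Fin m => A i) :=
  Submodule.sub_mem _ hx (Submodule.smul_mem _ _ (Submodule.subset_span ⟨i, rfl⟩))

/-- The squared error after one Kaczmarz step, multiplied by the squared norm of the chosen row. -/
lemma row_sq_sum_mul_rkStep_error {m n : ℕ} (A : Matrix (Fin m) (Fin n) ℝ) (b : Fin m → ℝ)
    (x y : Fin n → ℝ) {i : Fin m} (h : A i ≠ 0) :
    (∑ l, A i l ^ 2) * ∑ l, (rkStep A b x i - y) l ^ 2 =
      (∑ l, A i l ^ 2) * (∑ l, (x - y) l ^ 2)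
        + ((A.mulVec y - b) i ^ 2 - A.mulVec (x - y) i ^ 2) := by
  have hs := (row_sq_sum_pos h).ne'
  have hd : A.mulVec (x - y) i = ∑ l, A i l * (x - y) l := rfl
  have hr : A.mulVec x i - b i = A.mulVec (x - y) i + (A.mulVec y - b) i := by
    simp [Matrix.mulVec_sub]
  have expand (c : ℝ) : ∑ l, (x - c • A i - y) l ^ 2 =
      ∑ l, (x - y) l ^ 2 - 2 * c * (∑ l, A i l * (x - y) l) + c ^ 2 * ∑ l, A i l ^ 2 := by
    rw [Finset.mul_sum, Finset.mul_sum, ← Finset.sum_sub_distrib, ← Finset.sum_add_distrib]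
    refine Finset.sum_congr rfl fun l _ => ?_
    simp only [Pi.sub_apply, Pi.smul_apply, smul_eq_mul]
    ring
  rw [rkStep, expand, ← hd, hr]
  field_simp
  ring

/-- The expected squared error after one Kaczmarz step. -/
lemma sum_weight_mul_rkStep_error {m n : ℕ} [NeZero m] (A : Matrix (Fin m) (Fin n) ℝ)
    (b : Fin m → ℝ) (x y : Fin n → ℝ) (hrows : ∀ i, A i ≠ 0) :
    ∑ i, (∑ l, A i l ^ 2) / (∑ i', ∑ l, A i' l ^ 2) * ∑ l, (rkStep A b x i - y) l ^ 2 =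
      (∑ l, (x - y) l ^ 2) + ((∑ i, (A.mulVec y - b) i ^ 2) - ∑ i, A.mulVec (x - y) i ^ 2)
        / (∑ i', ∑ l, A i' l ^ 2) := by
  have hF : 0 < ∑ i', ∑ l, A i' l ^ 2 :=
    Finset.sum_pos (fun i _ => row_sq_sum_pos (hrows i)) Finset.univ_nonempty
  simp only [div_mul_eq_mul_div, row_sq_sum_mul_rkStep_error A b x y (hrows _)]
  rw [← Finset.sum_div, Finset.sum_add_distrib, Finset.sum_sub_distrib, ← Finset.sum_mul]
  field_simp

lemma sum_prod_mul_foldl_ofFn_succ {ι α : Type*} [Fintype ι] (k : ℕ) (w : ι → ℝ)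
    (f : α → ι → α) (g : α → ℝ) (x : α) :
    ∑ ω : Fin (k + 1) → ι, (∏ t, w (ω t)) * g ((List.ofFn ω).foldl f x) =
      ∑ i, w i * ∑ ω : Fin k → ι, (∏ t, w (ω t)) * g ((List.ofFn ω).foldl f (f x i)) := by
  rw [← (Fin.consEquiv fun _ : Fin (k + 1) => ι).sum_comp, Fintype.sum_prod_type]
  simp [Fin.consEquiv, Fin.prod_univ_succ, List.ofFn_succ, Finset.mul_sum, mul_assoc]

/-- Randomized Kaczmarz on inconsistent systems converges to a horizon. -/
theorem rk_inconsistent_horizon {m n : ℕ} (k : ℕ)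
    (A : Matrix (Fin m) (Fin n) ℝ) (b : Fin m → ℝ) (xs : Fin n → ℝ) (σ : ℝ)
    (hrows : ∀ i, A i ≠ 0)
    (hnormal : Aᵀ.mulVec (A.mulVec xs - b) = 0)
    (hxs : xs ∈ Submodule.span ℝ (Set.range fun i : Fin m => A i))
    (hσ : 0 < σ)
    (hmin : ∀ v ∈ Submodule.span ℝ (Set.range fun i : Fin m => A i),
      σ ^ 2 * (∑ l, v l ^ 2) ≤ ∑ l, A.mulVec v l ^ 2)
    (ρ : ℝ) (hρ : ρ = 1 - σ ^ 2 / (∑ i', ∑ l, A i' l ^ 2))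
    (x0 : Fin n → ℝ)
    (hx0 : x0 ∈ Submodule.span ℝ (Set.range fun i : Fin m => A i)) :
    ∑ ω : Fin k → Fin m,
        (∏ t, (∑ l, A (ω t) l ^ 2) / (∑ i', ∑ l, A i' l ^ 2)) *
          (∑ l, ((List.ofFn ω).foldl (rkStep A b) x0 - xs) l ^ 2)
      ≤ ρ ^ k * (∑ l, (x0 - xs) l ^ 2)
        + ((1 - ρ ^ k) / σ ^ 2) * ∑ i, (A.mulVec xs - b) i ^ 2 := by
  set F := ∑ i', ∑ l, A i' l ^ 2 with hFdef
  set R := ∑ i, (A.mulVec xs - b) i ^ 2 with hRdef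
  rcases Nat.eq_zero_or_pos m with rfl | hm
  · have hρ1 : ρ = 1 := by simp [hρ, hFdef]
    cases k with
    | zero => simp
    | succ k =>
      have : 0 ≤ ∑ l, (x0 - xs) l ^ 2 := Finset.sum_nonneg fun _ _ => sq_nonneg _
      simpa [hρ1] using this
  have : NeZero m := ⟨hm.ne'⟩
  have hF : 0 < F := Finset.sum_pos (fun i _ => row_sq_sum_pos (hrows i)) Finset.univ_nonempty
  have hρ0 : 0 ≤ ρ := by
    have hσF : σ ^ 2 ≤ F := le_of_mul_le_mul_right
      ((hmin (A 0) (Submodule.subset_span ⟨0, rfl⟩)).trans (sum_mulVec_sq_le A (A 0)))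
      (row_sq_sum_pos (hrows 0))
    rw [hρ, sub_nonneg]
    exact (div_le_one hF).2 hσF
  have hw : ∑ i, (∑ l, A i l ^ 2) / F = 1 := by
    rw [← Finset.sum_div]
    exact div_self hF.ne'
  have one_step (x : Fin n → ℝ) (hx : x ∈ Submodule.span ℝ (Set.range fun i : Fin m => A i)) :
      ∑ i, (∑ l, A i l ^ 2) / F * ∑ l, (rkStep A b x i - xs) l ^ 2
        ≤ ρ * (∑ l, (x - xs) l ^ 2) + R / F := by
    have h := div_le_div_of_nonneg_right (hmin _ (Submodule.sub_mem _ hx hxs)) hF.le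
    rw [sum_weight_mul_rkStep_error A b x xs hrows, hρ, sub_div]
    linear_combination h
  induction k generalizing x0 with
  | zero => simp
  | succ k ih =>
    rw [sum_prod_mul_foldl_ofFn_succ k (fun i => (∑ l, A i l ^ 2) / F) (rkStep A b)
      (fun z => ∑ l, (z - xs) l ^ 2)]
    calc
      _ ≤ ∑ i, (∑ l, A i l ^ 2) / F * (ρ ^ k * (∑ l, (rkStep A b x0 i - xs) l ^ 2)
            + ((1 - ρ ^ k) / σ ^ 2) * R) :=
        Finset.sum_le_sum fun i _ => mul_le_mul_of_nonneg_left
          (ih _ (rkStep_mem_span A b hx0 i))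
          (div_nonneg (row_sq_sum_pos (hrows i)).le hF.le)
      _ = ρ ^ k * (∑ i, (∑ l, A i l ^ 2) / F * ∑ l, (rkStep A b x0 i - xs) l ^ 2)
            + ((1 - ρ ^ k) / σ ^ 2) * R := by
        simp only [mul_add, Finset.sum_add_distrib, ← Finset.sum_mul, hw, one_mul,
          mul_left_comm _ (ρ ^ k), ← Finset.mul_sum]
      _ ≤ ρ ^ k * (ρ * (∑ l, (x0 - xs) l ^ 2) + R / F) + ((1 - ρ ^ k) / σ ^ 2) * R := by
        gcongr
        exact one_step x0 hx0
      _ = ρ ^ (k + 1) * (∑ l, (x0 - xs) l ^ 2) + ((1 - ρ ^ (k + 1)) / σ ^ 2) * R := by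
        have hinv : 1 / F = (1 - ρ) / σ ^ 2 := by
          rw [hρ]
          field_simp
          ring
        linear_combination ρ ^ k * R * hinv
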